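/- Let D be a finite oriented graph missing a matching and let C = a₁b₁, a₂b₂, …, a_kb_k be a directed cycle of its dependency digraph Δ. Then K(C) = {a₁,b₁,…,a_k,b_k} is an interval of D. -/

import Mathlib

variable {V : Type*}

/-- Out-neighborhood of `v`. -/
def Nplus (E : V → V → Prop) (v : V) : Set V := {w | E v w}

/-- In-neighborhood of `v`. -/
def Nminus (E : V → V → Prop) (v : V) : Set V := {w | E w v}

/-- Second out-neighborhood: vertices at directed distance exactly 2 from `v`. -/
def Npp (E : V → V → Prop) (v : V) : Set V :=
  {w | w ≠ v ∧ ¬ E v w ∧ ∃ u, E v u ∧ E u w}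

/-- Weight of a set of vertices. -/
noncomputable def wt (ω : V → ℝ) (S : Set V) : ℝ := ∑ᶠ x ∈ S, ω x

/-- Total weight of the forward arcs of the ordering `L`. -/
noncomputable def fwdW {n : ℕ} (E : V → V → Prop) (ω : V → ℝ) (L : Fin n ≃ V) : ℝ :=
  ∑ᶠ p ∈ {p : Fin n × Fin n | p.1 < p.2 ∧ E (L p.1) (L p.2)}, ω (L p.1) * ω (L p.2)

/-- `L` is a weighted median order of `(E, ω)`. -/
def IsWMedian {n : ℕ} (E : V → V → Prop) (ω : V → ℝ) (L : Fin n ≃ V) : Prop :=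
  ∀ L' : Fin n ≃ V, fwdW E ω L' ≤ fwdW E ω L

/-- Number of forward arcs of the ordering `L`. -/
noncomputable def fwdCount {n : ℕ} (E : V → V → Prop) (L : Fin n ≃ V) : ℕ :=
  Set.ncard {p : Fin n × Fin n | p.1 < p.2 ∧ E (L p.1) (L p.2)}

/-- `L` is a (unweighted) median order of `E`. -/
def IsMedian {n : ℕ} (E : V → V → Prop) (L : Fin n ≃ V) : Prop :=
  ∀ L' : Fin n ≃ V, fwdCount E L' ≤ fwdCount E L

/-- `K` is an interval of the digraph `E`. -/
def IsInterval (E : V → V → Prop) (K : Set V) : Prop :=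
  ∀ u ∈ K, ∀ v ∈ K,
    Nplus E u \ K = Nplus E v \ K ∧ Nminus E u \ K = Nminus E v \ K

/-- `K` occurs as a set of consecutive vertices of the ordering `L`. -/
def OrderConvex {n : ℕ} (L : Fin n ≃ V) (K : Set V) : Prop :=
  ∀ i j k : Fin n, i ≤ j → j ≤ k → L i ∈ K → L k ∈ K → L j ∈ K

/-- `{x, y}` is a missing edge. -/
def IsMissing (E : V → V → Prop) (x y : V) : Prop := x ≠ y ∧ ¬ E x y ∧ ¬ E y x

/-- The unordered pair `e` is a missing edge. -/
def IsMissingS (E : V → V → Prop) (e : Sym2 V) : Prop :=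
  ∃ x y, e = s(x, y) ∧ IsMissing E x y

/-- The labelled losing relation: the missing edge `x₁y₁` loses to the missing edge `x₂y₂`
with this labelling of the endpoints. -/
def LosesLab (E : V → V → Prop) (x1 y1 x2 y2 : V) : Prop :=
  IsMissing E x1 y1 ∧ IsMissing E x2 y2 ∧
  E x1 x2 ∧ y2 ∉ Nplus E x1 ∪ Npp E x1 ∧ E y1 y2 ∧ x2 ∉ Nplus E y1 ∪ Npp E y1

/-- The losing relation on missing edges: the arcs of the dependency digraph `Δ`. -/
def Loses (E : V → V → Prop) (e f : Sym2 V) : Prop :=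
  ∃ x1 y1 x2 y2, e = s(x1, y1) ∧ f = s(x2, y2) ∧ LosesLab E x1 y1 x2 y2

/-- One merging step used to generate the sets `K(ξ)`. -/
def MissTouch (E : V → V → Prop) (u v : V) : Prop :=
  IsMissing E u v ∨ ∃ e f : Sym2 V, Loses E e f ∧ u ∈ e ∧ v ∈ f

/-- `u` and `v` lie in the same set `K(ξ)` (or `u = v`). -/
def SameK (E : V → V → Prop) : V → V → Prop := Relation.EqvGen (MissTouch E)

/-- `J(f)`: equal to `{f}` when `f` is whole, and to `K(ξ)` for the unique connected
component `ξ` of the interval graph with `f ∈ K(ξ)` otherwise. -/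
def Jset (E : V → V → Prop) (f : V) : Set V := {v | SameK E f v}

/-- A good digraph: all sets `K(ξ)` are intervals. -/
def GoodDigraph (E : V → V → Prop) : Prop := ∀ f : V, IsInterval E (Jset E f)

/-- The set `G_L` of good vertices of the ordering `L`. -/
def GoodSet {n : ℕ} (E : V → V → Prop) (L : Fin (n + 1) ≃ V) : Set V :=
  {w | w ∉ Nplus E (L (Fin.last n)) ∧
    ∃ i j : Fin (n + 1), i ≤ j ∧ w = L j ∧ E (L (Fin.last n)) (L i) ∧ E (L i) w}

/-- The subdigraph of `E` induced on `K`. -/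
def ERestrict (E : V → V → Prop) (K : Set V) : V → V → Prop :=
  fun x y => x ∈ K ∧ y ∈ K ∧ E x y

/-- `(a, b)` is a convenient orientation of the missing edge `ab`. -/
def ConvenientFor (E : V → V → Prop) (a b : V) : Prop :=
  ∀ v, v ≠ a → v ≠ b → E v a → b ∈ Nplus E v ∪ Npp E v

/-- Two missing edges lie in the same connected component of the dependency digraph. -/
def DeltaConn (E : V → V → Prop) : Sym2 V → Sym2 V → Prop :=
  Relation.ReflTransGen (fun e f => Loses E e f ∨ Loses E f e)

/-- The connected component of `e` in the dependency digraph is a (maximal directed) path,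
i.e. it contains a missing edge of in-degree zero. -/
def InPathComp (E : V → V → Prop) (e : Sym2 V) : Prop :=
  ∃ f, IsMissingS E f ∧ DeltaConn E e f ∧ ¬ ∃ g, Loses E g f

theorem LosesLab.swap' {V : Type*} {E : V → V → Prop} {x1 y1 x2 y2 : V}
    (h : LosesLab E x1 y1 x2 y2) : LosesLab E y1 x1 y2 x2 := by
  obtain ⟨h1, h2, h3, h4, h5, h6⟩ := h
  exact ⟨⟨h1.1.symm, h1.2.2, h1.2.1⟩, ⟨h2.1.symm, h2.2.2, h2.2.1⟩, h5, h6, h3, h4⟩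

theorem LosesLab.step {V : Type*} {E : V → V → Prop}
    (hmatch : ∀ a b c, IsMissing E a b → IsMissing E a c → b = c) {x1 y1 x2 y2 w : V}
    (h : LosesLab E x1 y1 x2 y2) (hx : w ≠ x2) (hy : w ≠ y2) (hw : E x1 w) : E y2 w := by
  obtain ⟨h1, h2, h3, h4, h5, h6⟩ := h
  by_contra hn
  have h7 : ¬ E w y2 := by
    intro h8
    apply h4
    by_cases h9 : E x1 y2
    · exact Or.inl h9
    · refine Or.inr ⟨?_, h9, w, hw, h8⟩
      rintro rfl
      exact h2.2.2 h3
  exact hx (hmatch y2 w x2 ⟨hy.symm, hn, h7⟩ ⟨h2.1.symm, h2.2.2, h2.2.1⟩)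

theorem LosesLab.back {V : Type*} {E : V → V → Prop} (hloop : ∀ v, ¬ E v v)
    (hmatch : ∀ a b c, IsMissing E a b → IsMissing E a c → b = c) {x1 y1 x2 y2 : V}
    (h : LosesLab E x1 y1 x2 y2) : E y2 x1 := by
  obtain ⟨h1, h2, h3, h4, h5, h6⟩ := h
  by_contra hn
  have h7 : ¬ E x1 y2 := fun h => h4 (Or.inl h)
  have h8 : y2 ≠ x1 := by
    rintro rfl
    exact h2.2.2 h3
  have := hmatch y2 x1 x2 ⟨h8, hn, h7⟩ ⟨h2.1.symm, h2.2.2, h2.2.1⟩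
  subst this
  exact hloop _ h3

theorem stmt_10 {V : Type*} [Fintype V]
    (E : V → V → Prop) (hloop : ∀ v, ¬ E v v) (hdigon : ∀ x y, ¬ (E x y ∧ E y x))
    (hmatch : ∀ a b c, IsMissing E a b → IsMissing E a c → b = c)
    (k : ℕ) (hk : 1 ≤ k) (a b : ℕ → V)
    (hmiss : ∀ i, 1 ≤ i → i ≤ k → IsMissing E (a i) (b i))
    (hpath : ∀ i, 1 ≤ i → i < k → LosesLab E (a i) (b i) (a (i + 1)) (b (i + 1)))
    (hclose : Loses E s(a k, b k) s(a 1, b 1))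
    (hinj : ∀ i j, 1 ≤ i → i ≤ k → 1 ≤ j → j ≤ k → s(a i, b i) = s(a j, b j) → i = j) :
    IsInterval E {v | ∃ i, 1 ≤ i ∧ i ≤ k ∧ (v = a i ∨ v = b i)} := by
  classical
  obtain ⟨p, q, hp1, hq1, hpq, hp⟩ : ∃ p q : ℕ → V, p 1 = a 1 ∧ q 1 = b 1 ∧
      (∀ i, (p i = a i ∧ q i = b i) ∨ (p i = b i ∧ q i = a i)) ∧
      (∀ i, 1 ≤ i → i < k → LosesLab E (p i) (q i) (q (i + 1)) (p (i + 1))) := by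
    refine ⟨fun i => if Odd i then a i else b i, fun i => if Odd i then b i else a i,
      by simp, by simp, ?_, ?_⟩
    · intro i
      by_cases h : Odd i <;> simp [h]
    · intro i h1 h2
      have h3 := hpath i h1 h2
      by_cases h : Odd i
      · have h' : ¬ Odd (i + 1) := by rw [Nat.odd_add_one]; simpa using h
        simpa only [h, h', if_true, if_false] using h3
      · have h' : Odd (i + 1) := by rw [Nat.odd_add_one]; exact h
        simpa only [h, h', if_true, if_false] using h3.swap'
  have hmiss' : ∀ i, 1 ≤ i → i ≤ k → IsMissing E (p i) (q i) := by
    intro i h1 h2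
    have h3 := hmiss i h1 h2
    rcases hpq i with ⟨e1, e2⟩ | ⟨e1, e2⟩ <;> rw [e1, e2]
    · exact h3
    · exact ⟨h3.1.symm, h3.2.2, h3.2.1⟩
  have hinj' : ∀ i, 1 ≤ i → i ≤ k → (p 1 = p i ∨ p 1 = q i) → i = 1 := by
    intro i h1 h2 h3
    apply hinj i 1 h1 h2 le_rfl hk
    have m1 := hmiss' 1 le_rfl hk
    have m := hmiss' i h1 h2
    have e1 : s(a i, b i) = s(p i, q i) := by
      rcases hpq i with ⟨e1, e2⟩ | ⟨e1, e2⟩ <;> rw [e1, e2]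
      exact Sym2.eq_swap
    rw [e1, ← hp1, ← hq1]
    rcases h3 with h3 | h3
    · rw [← h3] at m ⊢
      rw [hmatch _ _ _ m1 m]
    · rw [← h3] at m ⊢
      rw [hmatch _ _ _ m1 ⟨m.1.symm, m.2.2, m.2.1⟩]
      exact Sym2.eq_swap
  -- chains
  have chainP : ∀ w i, 1 ≤ i → ∀ j, i ≤ j → j ≤ k →
      (∀ l, i < l → l ≤ k → w ≠ p l ∧ w ≠ q l) → E (p i) w → E (p j) w := by
    intro w i hi j hij
    induction j, hij using Nat.le_induction with
    | base => intro _ _ h; exact h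
    | succ j hij ih =>
      intro hj hw h
      have h1 := ih (by omega) hw h
      have h2 := hw (j + 1) (by omega) hj
      exact (hp j (by omega) (by omega)).step hmatch h2.2 h2.1 h1
  have chainQ : ∀ w i, 1 ≤ i → ∀ j, i ≤ j → j ≤ k →
      (∀ l, i < l → l ≤ k → w ≠ p l ∧ w ≠ q l) → E (q i) w → E (q j) w := by
    intro w i hi j hij
    induction j, hij using Nat.le_induction with
    | base => intro _ _ h; exact h
    | succ j hij ih =>
      intro hj hw h
      have h1 := ih (by omega) hw h
      have h2 := hw (j + 1) (by omega) hj
      exact (hp j (by omega) (by omega)).swap'.step hmatch h2.1 h2.2 h1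
  have hcl : LosesLab E (p k) (q k) (p 1) (q 1) := by
    have hor : LosesLab E (p k) (q k) (p 1) (q 1) ∨ LosesLab E (q k) (p k) (p 1) (q 1) := by
      obtain ⟨x1, y1, x2, y2, e1, e2, h⟩ := hclose
      rw [hp1, hq1]
      have h' := h.swap'
      rw [Sym2.eq_iff] at e1 e2
      rcases hpq k with ⟨f1, f2⟩ | ⟨f1, f2⟩ <;> rw [f1, f2] <;>
      rcases e1 with ⟨g1, g2⟩ | ⟨g1, g2⟩ <;> rcases e2 with ⟨g3, g4⟩ | ⟨g3, g4⟩ <;>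
      rw [g1, g2, g3, g4] <;> tauto
    rcases hor with h | h
    · exact h
    · exfalso
      rcases Nat.lt_or_ge 1 k with hk2 | hk2
      · have h1 : E (p 2) (p 1) := (hp 1 le_rfl hk2).back hloop hmatch
        have h2 := chainP (p 1) 2 (by omega) k hk2 le_rfl (by
          intro l hl hlk
          constructor <;> intro he
          · have := hinj' l (by omega) hlk (Or.inl he); omega
          · have := hinj' l (by omega) hlk (Or.inr he); omega) h1
        exact h.2.2.2.2.2 (Or.inl h2)
      · have : k = 1 := by omega
        subst this
        exact (hmiss' 1 le_rfl le_rfl).2.2 h.2.2.1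
  set K : Set V := {v | ∃ i, 1 ≤ i ∧ i ≤ k ∧ (v = a i ∨ v = b i)} with hK
  have hKmem : ∀ v, v ∈ K ↔ ∃ i, 1 ≤ i ∧ i ≤ k ∧ (v = p i ∨ v = q i) := by
    intro v
    constructor
    · rintro ⟨i, h1, h2, h3⟩
      refine ⟨i, h1, h2, ?_⟩
      rcases hpq i with ⟨e1, e2⟩ | ⟨e1, e2⟩ <;> rw [e1, e2] <;> tauto
    · rintro ⟨i, h1, h2, h3⟩
      refine ⟨i, h1, h2, ?_⟩
      rcases hpq i with ⟨e1, e2⟩ | ⟨e1, e2⟩ <;> rw [e1, e2] at h3 <;> tauto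
  have key : ∀ w, w ∉ K → ∀ v ∈ K, (E v w ↔ E (p 1) w) := by
    intro w hw v hv
    have hne : ∀ l, 1 ≤ l → l ≤ k → w ≠ p l ∧ w ≠ q l := by
      intro l h1 h2
      constructor <;> intro he <;> apply hw <;> rw [hKmem]
      · exact ⟨l, h1, h2, Or.inl he⟩
      · exact ⟨l, h1, h2, Or.inr he⟩
    have n1 := hne 1 le_rfl hk
    have cP : E (p k) w → E (q 1) w := hcl.step hmatch n1.1 n1.2
    have cQ : E (q k) w → E (p 1) w := hcl.swap'.step hmatch n1.2 n1.1
    have P := fun i (hi : 1 ≤ i) j hij hj =>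
      chainP w i hi j hij hj (fun l h1 h2 => hne l (by omega) h2)
    have Q := fun i (hi : 1 ≤ i) j hij hj =>
      chainQ w i hi j hij hj (fun l h1 h2 => hne l (by omega) h2)
    obtain ⟨i, h1, h2, rfl | rfl⟩ := (hKmem v).1 hv
    · exact ⟨fun h => cQ (Q 1 le_rfl k hk le_rfl (cP (P i h1 k h2 le_rfl h))),
        fun h => P 1 le_rfl i h1 h2 h⟩
    · exact ⟨fun h => cQ (Q i h1 k h2 le_rfl h),
        fun h => Q 1 le_rfl i h1 h2 (cP (P 1 le_rfl k hk le_rfl h))⟩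
  have dual : ∀ w, w ∉ K → ∀ v ∈ K, (E w v ↔ ¬ E v w) := by
    intro w hw v hv
    refine ⟨fun h h' => hdigon _ _ ⟨h, h'⟩, fun h => ?_⟩
    by_contra h'
    have hvw : IsMissing E v w := ⟨fun e => hw (e ▸ hv), h, h'⟩
    obtain ⟨i, h1, h2, rfl | rfl⟩ := (hKmem v).1 hv
    · have := hmatch _ _ _ hvw (hmiss' i h1 h2)
      exact hw ((hKmem w).2 ⟨i, h1, h2, Or.inr this⟩)
    · have m := hmiss' i h1 h2
      have := hmatch _ _ _ hvw ⟨m.1.symm, m.2.2, m.2.1⟩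
      exact hw ((hKmem w).2 ⟨i, h1, h2, Or.inl this⟩)
  intro u hu v hv
  constructor
  · ext w
    constructor
    · rintro ⟨h, hw⟩
      exact ⟨(key w hw v hv).2 ((key w hw u hu).1 h), hw⟩
    · rintro ⟨h, hw⟩
      exact ⟨(key w hw u hu).2 ((key w hw v hv).1 h), hw⟩
  · ext w
    constructor
    · rintro ⟨h, hw⟩
      refine ⟨(dual w hw v hv).2 fun h' => ?_, hw⟩
      exact (dual w hw u hu).1 h ((key w hw u hu).2 ((key w hw v hv).1 h'))
    · rintro ⟨h, hw⟩
      refine ⟨(dual w hw u hu).2 fun h' => ?_, hw⟩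
      exact (dual w hw v hv).1 h ((key w hw v hv).2 ((key w hw u hu).1 h'))
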